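/- Let k be a field of characteristic zero and X = (x_{ij}) an r×n matrix of independent indeterminates with r ≤ n. Let L be a ladder of X, i.e., a subset of the entries of X such that whenever x_{ij}, x_{pq} ∈ L with i < p and j < q, also x_{iq}, x_{pj} ∈ L. Let R = k[L] be the polynomial ring on the variables in L, let I_t(L) be the ideal of R generated by the t×t minors of X all of whose entries lie in L, and let m be the largest integer such that all entries of some m×m submatrix of X belong to L. Then for every 1 ≤ t ≤ m, every positive integer k, and every integer 0 ≤ l ≤ m−t, α(I_t(L)^{(k(m−t+1)−l)}) = km − l; moreover, the Waldschmidt constant of I_t(L) equals m/(m−t+1), i.e., α(I_t(L)^{(s)})/s → m/(m−t+1) as s → ∞. -/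

import Mathlib

open MvPolynomial Filter

/-- The `s`-th symbolic power of an ideal: the intersection over the associated primes `p` of
`R ⧸ I` of the contractions of `I^s` localized at `p`. -/
noncomputable def symbolicPower {R : Type*} [CommRing R] (I : Ideal R) (s : ℕ) : Ideal R :=
  ⨅ p : {p : Ideal R // p ∈ associatedPrimes R (R ⧸ I)},
    letI : p.1.IsPrime := p.2.isPrime
    Ideal.comap (algebraMap R (Localization.AtPrime p.1))
      (Ideal.map (algebraMap R (Localization.AtPrime p.1)) (I ^ s))

/-- The least degree of a nonzero homogeneous element of an ideal of a polynomial ring. -/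
noncomputable def alphaDeg {σ K : Type*} [CommSemiring K] (I : Ideal (MvPolynomial σ K)) : ℕ :=
  sInf {d | ∃ f ∈ I, f ≠ 0 ∧ MvPolynomial.IsHomogeneous f d}


def ChainTo (s : Set (ℕ × ℕ)) : ℕ → ℕ × ℕ → Prop
  | 0, x => x ∈ s
  | a + 1, x => x ∈ s ∧ ∃ y : ℕ × ℕ, y.1 < x.1 ∧ y.2 < x.2 ∧ ChainTo s a y

lemma ChainTo.mem {s : Set (ℕ × ℕ)} {a : ℕ} {x : ℕ × ℕ} (h : ChainTo s a x) : x ∈ s := by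
  cases a with
  | zero => exact h
  | succ a => exact h.1

lemma ChainTo.mono {s s' : Set (ℕ × ℕ)} (hs : s ⊆ s') {a : ℕ} : ∀ {x : ℕ × ℕ},
    ChainTo s a x → ChainTo s' a x := by
  induction a with
  | zero => intro x h; exact hs h
  | succ a ih => rintro x ⟨h, y, h1, h2, h3⟩; exact ⟨hs h, y, h1, h2, ih h3⟩

def Adm (k : ℕ) (c : ℕ → ℕ) (s : Set (ℕ × ℕ)) : Prop :=
  ∀ a x, ChainTo s a x → a < k ∧ c a ≤ x.2

lemma digits_unique (B : ℕ) (n : ℕ) : ∀ (d d' : ℕ → ℕ), (∀ j, d j < B) → (∀ j, d' j < B) →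
    ∑ j ∈ Finset.range n, d j * B ^ j = ∑ j ∈ Finset.range n, d' j * B ^ j →
    ∀ j < n, d j = d' j := by
  induction n with
  | zero => intro d d' _ _ _ j hj; omega
  | succ n ih =>
    intro d d' h h' he j hj
    have hB : 0 < B := lt_of_le_of_lt (Nat.zero_le _) (h 0)
    rw [Finset.sum_range_succ', Finset.sum_range_succ'] at he
    have e1 : ∀ d : ℕ → ℕ, ∑ j ∈ Finset.range n, d (j+1) * B ^ (j+1) =
        B * ∑ j ∈ Finset.range n, d (j+1) * B ^ j := by
      intro d
      rw [Finset.mul_sum]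
      refine Finset.sum_congr rfl fun j _ => ?_
      ring
    rw [e1 d, e1 d'] at he
    simp only [pow_zero, mul_one] at he
    have h0 : d 0 = d' 0 := by
      have := congrArg (· % B) he
      simpa [Nat.mul_add_mod, Nat.mod_eq_of_lt (h 0), Nat.mod_eq_of_lt (h' 0)] using this
    rw [h0] at he
    have h2 := Nat.eq_of_mul_eq_mul_left hB (Nat.add_right_cancel he)
    cases j with
    | zero => exact h0
    | succ j => exact ih (fun j => d (j+1)) (fun j => d' (j+1)) (fun j => h _) (fun j => h' _) h2 j (by omega)

/-- weights separating the last rows -/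
lemma exists_weight (F : Finset (ℕ × ℕ →₀ ℕ)) (i : ℕ) : ∃ w : ℕ → ℕ, StrictMono w ∧
    ∀ m ∈ F, ∀ m' ∈ F,
      Finsupp.weight (fun x : ℕ × ℕ => if x.1 = i then w x.2 else 0) m =
      Finsupp.weight (fun x : ℕ × ℕ => if x.1 = i then w x.2 else 0) m' →
      ∀ j, m (i, j) = m' (i, j) := by
  classical
  let B := (∑ m ∈ F, m.degree) + 2
  let V := F.biUnion (fun m => m.support)
  let n := (∑ x ∈ V, x.2) + 1
  have hdig : ∀ m ∈ F, ∀ x, m x < B := by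
    intro m hm x
    have h1 := Finset.single_le_sum (f := fun m : ℕ × ℕ →₀ ℕ => m.degree) (fun _ _ => Nat.zero_le _) hm
    have h2 := Finsupp.le_degree x m
    omega
  have hn : ∀ m ∈ F, ∀ x ∈ m.support, x.2 < n := by
    intro m hm x hx
    have := Finset.single_le_sum (f := fun x : ℕ × ℕ => x.2) (fun _ _ => Nat.zero_le _)
      (show x ∈ V from Finset.mem_biUnion.2 ⟨m, hm, hx⟩)
    omega
  have hw : ∀ m ∈ F, Finsupp.weight (fun x : ℕ × ℕ => if x.1 = i then B ^ x.2 else 0) m =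
      ∑ j ∈ Finset.range n, m (i, j) * B ^ j := by
    intro m hm
    rw [Finsupp.weight_apply, Finsupp.sum]
    simp only [smul_eq_mul, mul_ite, mul_zero]
    rw [← Finset.sum_filter]
    symm
    rw [← Finset.sum_filter_ne_zero]
    refine Finset.sum_of_injOn (fun j => (i, j)) (fun a _ b _ h => by simpa using h) ?_ ?_ ?_
    · intro j hj
      simp only [Finset.coe_filter, Set.mem_ofPred_eq, Finset.mem_range] at hj ⊢
      exact ⟨Finsupp.mem_support_iff.2 (fun h => hj.2 (by simp [h])), trivial⟩
    · rintro ⟨a, b⟩ hx hx'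
      simp only [Finset.mem_filter] at hx
      obtain ⟨hx, rfl⟩ := hx
      by_contra h0
      refine hx' ⟨b, ?_, rfl⟩
      simp only [Finset.coe_filter, Set.mem_ofPred_eq, Finset.mem_range]
      exact ⟨hn m hm _ hx, h0⟩
    · intro j _; rfl
  refine ⟨fun j => B ^ j, pow_right_strictMono₀ (show 1 < B by omega), ?_⟩
  intro m hm m' hm' he j
  rw [hw m hm, hw m' hm'] at he
  by_cases hj : j < n
  · exact digits_unique B n (fun j => m (i, j)) (fun j => m' (i, j)) (fun j => hdig m hm _)
      (fun j => hdig m' hm' _) he j hj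
  · have hz : ∀ m ∈ F, m (i, j) = 0 := by
      intro m hm
      by_contra h
      exact hj (hn m hm (i, j) (Finsupp.mem_support_iff.2 h))
    rw [hz m hm, hz m' hm']

lemma exists_bump (k : ℕ) (c : ℕ → ℕ) (hc : ∀ a b, a < b → b < k → c a < c b) (S : Finset ℕ) :
    ∃ c' : ℕ → ℕ, (∀ a, c a ≤ c' a) ∧ (∀ a, a + 1 < k → c' a < c (a + 1)) ∧
      (∀ a, c' a = c a ∨ c' a ∈ S) ∧
      (∀ a, ∀ j ∈ S, c a ≤ j → (a + 1 < k → j < c (a + 1)) → j ≤ c' a) := by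
  classical
  let Q : ℕ → Finset ℕ := fun a =>
    insert (c a) (S.filter fun j => c a ≤ j ∧ (a + 1 < k → j < c (a + 1)))
  have hQ : ∀ a, (Q a).Nonempty := fun a => ⟨c a, Finset.mem_insert_self _ _⟩
  have hmem : ∀ a, (Q a).max' (hQ a) = c a ∨ ((Q a).max' (hQ a) ∈ S ∧ c a ≤ (Q a).max' (hQ a) ∧
      (a + 1 < k → (Q a).max' (hQ a) < c (a + 1))) := by
    intro a
    have := (Q a).max'_mem (hQ a)
    simpa only [Q, Finset.mem_insert, Finset.mem_filter] using this
  refine ⟨fun a => (Q a).max' (hQ a), fun a => ?_, fun a ha => ?_, fun a => ?_, fun a j hj h1 h2 => ?_⟩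
  · exact Finset.le_max' _ _ (Finset.mem_insert_self _ _)
  · rcases hmem a with h | h
    · simp only [h]; exact hc _ _ (by omega) ha
    · exact h.2.2 ha
  · rcases hmem a with h | h
    · exact Or.inl h
    · exact Or.inr h.1
  · exact Finset.le_max' _ _ (by simp [Q]; exact Or.inr ⟨hj, h1, h2⟩)

theorem star_aux {K : Type*} [Field K] [Infinite K] (k : ℕ) : ∀ (i : ℕ) (c : ℕ → ℕ)
    (_ : ∀ a b, a < b → b < k → c a < c b) (f : MvPolynomial (ℕ × ℕ) K) (_ : f ≠ 0)
    (_ : ∀ m ∈ f.support, ∀ x ∈ m.support, x.1 < i)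
    (_ : ∀ m ∈ f.support, Adm k c (m.support : Set (ℕ × ℕ))),
    ∃ (A : ℕ → ℕ → K) (E : ℕ → ℕ → K), (∀ a < k, ∀ j < c a, E a j = 0) ∧
      (∀ a < k, E a (c a) ≠ 0) ∧
      eval (fun x => ∑ a ∈ Finset.range k, A x.1 a * E a x.2) f ≠ 0 := by
  classical
  intro i
  induction i with
  | zero =>
    intro c hc f hf hrow _
    refine ⟨fun _ _ => 0, fun a j => if j < c a then 0 else 1, ?_, ?_, ?_⟩
    · intro a _ j hj; simp [hj]
    · intro a _; simp
    · have h0 : ∀ m ∈ f.support, m = 0 := by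
        intro m hm
        rw [← Finsupp.support_eq_empty, Finset.eq_empty_iff_forall_notMem]
        intro x hx
        exact absurd (hrow m hm x hx) (by omega)
      have hfC : f = C (coeff 0 f) := by
        ext m
        rw [coeff_C]
        split_ifs with h
        · rw [h]
        · by_contra h'
          exact h (h0 m (mem_support_iff.2 h')).symm
      rw [hfC, eval_C]
      intro h
      rw [h, C_0] at hfC
      exact hf hfC
  | succ i ih =>
    intro c hc f hf hrow hadm
    obtain ⟨w, hw, hsep⟩ := exists_weight f.support i
    set wt : ℕ × ℕ → ℕ := fun x => if x.1 = i then w x.2 else 0 with hwt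
    have hne : f.support.Nonempty := by
      rwa [Finset.nonempty_iff_ne_empty, Ne, MvPolynomial.support_eq_empty]
    obtain ⟨m0, hm0, hmax⟩ := Finset.exists_max_image f.support (Finsupp.weight wt) hne
    set W := Finsupp.weight wt m0 with hW
    set N := m0.filter (fun x => x.1 = i) with hN
    set S : Finset ℕ := N.support.image Prod.snd with hS
    have hSmem : ∀ j, j ∈ S ↔ (i, j) ∈ m0.support := by
      intro j
      simp only [hS, hN, Finset.mem_image, Finsupp.support_filter, Finset.mem_filter]
      constructor
      · rintro ⟨⟨a, b⟩, ⟨h1, rfl⟩, rfl⟩; exact h1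
      · intro h; exact ⟨(i, j), ⟨h, rfl⟩, rfl⟩
    obtain ⟨c', hcc', hc'c, hc'S, hSc'⟩ := exists_bump k c hc S
    set fW := weightedHomogeneousComponent wt W f with hfW
    set g := fW.divMonomial N with hg
    have hcg : ∀ p, coeff p g = if Finsupp.weight wt (N + p) = W then coeff (N + p) f else 0 := by
      intro p
      rw [hg, coeff_divMonomial, hfW, coeff_weightedHomogeneousComponent]
    have hlast : ∀ m ∈ f.support, Finsupp.weight wt m = W → ∀ j, m (i, j) = m0 (i, j) :=
      fun m hm h j => hsep m hm m0 hm0 h j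
    have hNle : ∀ m ∈ f.support, Finsupp.weight wt m = W → N ≤ m := by
      intro m hm h x
      rcases x with ⟨a, b⟩
      by_cases ha : a = i
      · subst ha; simp [hN, hlast m hm h b]
      · simp [hN, ha]
    have hfWg : fW = monomial N 1 * g := by
      ext m
      rw [coeff_monomial_mul']
      split_ifs with h
      · rw [hcg, add_tsub_cancel_of_le h, one_mul, hfW, coeff_weightedHomogeneousComponent]
      · rw [hfW, coeff_weightedHomogeneousComponent]
        split_ifs with h2
        · by_contra h3
          exact h (hNle m (mem_support_iff.2 h3) h2)
        · rfl
    have hg0 : g ≠ 0 := by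
      intro h
      rw [h, mul_zero] at hfWg
      have h1 : coeff m0 fW = coeff m0 f := by
        rw [hfW, coeff_weightedHomogeneousComponent, if_pos rfl]
      rw [hfWg, coeff_zero] at h1
      exact mem_support_iff.1 hm0 h1.symm
    have hgs : ∀ p ∈ g.support, N + p ∈ f.support ∧ Finsupp.weight wt (N + p) = W := by
      intro p hp
      have := mem_support_iff.1 hp
      rw [hcg] at this
      split_ifs at this with h
      · exact ⟨mem_support_iff.2 this, h⟩
      · exact absurd rfl this
    have hsub : ∀ p : ℕ × ℕ →₀ ℕ, (p.support : Set (ℕ × ℕ)) ⊆ ((N + p).support : Set (ℕ × ℕ)) := by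
      intro p x hx
      simp only [Finset.mem_coe, Finsupp.mem_support_iff, Finsupp.add_apply] at hx ⊢
      omega
    have hgrow : ∀ p ∈ g.support, ∀ x ∈ p.support, x.1 < i := by
      rintro p hp ⟨a, b⟩ hx
      obtain ⟨h1, h2⟩ := hgs p hp
      have h3 := hrow _ h1 (a, b) (hsub p hx)
      have h4 : a ≠ i := by
        rintro rfl
        have h5 := hlast _ h1 h2 b
        have h6 : N (a, b) = m0 (a, b) := by simp [hN]
        rw [Finsupp.add_apply, h6] at h5
        rw [Finsupp.mem_support_iff] at hx
        omega
      simp only at h3 ⊢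
      omega
    have hc' : ∀ a b, a < b → b < k → c' a < c' b := by
      intro a b hab hb
      have h1 := hc'c a (by omega)
      have h2 := hcc' b
      rcases Nat.lt_or_ge (a + 1) b with h | h
      · have := hc (a+1) b h hb; omega
      · have : b = a + 1 := by omega
        subst this; omega
    have hgadm : ∀ p ∈ g.support, Adm k c' (p.support : Set (ℕ × ℕ)) := by
      intro p hp a x hx
      obtain ⟨h1, h2⟩ := hgs p hp
      obtain ⟨h3, h4⟩ := hadm _ h1 a x (hx.mono (hsub p))
      refine ⟨h3, ?_⟩
      rcases hc'S a with h | h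
      · rw [h]; exact h4
      · by_contra hlt
        push Not at hlt
        have h5 : ChainTo ((N + p).support : Set (ℕ × ℕ)) (a + 1) (i, c' a) := by
          refine ⟨?_, x, hgrow p hp x hx.mem, hlt, hx.mono (hsub p)⟩
          have := (hSmem _).1 h
          simp only [Finset.mem_coe, Finsupp.mem_support_iff] at this ⊢
          rw [hlast _ h1 h2]; exact this
        obtain ⟨h6, h7⟩ := hadm _ h1 _ _ h5
        have := hc'c a h6
        simp only at h7
        omega
    obtain ⟨A, E, hE0, hE1, hev⟩ := ih c' hc' g hg0 hgrow hgadm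
    -- polynomial family
    let Eb : ℕ → ℕ → Polynomial K := fun a j =>
      if j < c a then 0 else if j < c' a then Polynomial.X ^ (w (c' a) - w j)
      else Polynomial.C (E a j)
    let U : ℕ → Polynomial K := fun j => ∑ a ∈ Finset.range k,
      if j < c a then 0 else if j < c' a then 1
      else Polynomial.X ^ (w j - w (c' a)) * Polynomial.C (E a j)
    let Y : ℕ × ℕ → Polynomial K := fun x => if x.1 = i then U x.2 else
      ∑ a ∈ Finset.range k, Polynomial.C (A x.1 a) * Eb a x.2
    let h : Polynomial K := ∑ m ∈ f.support, Polynomial.C (coeff m f) *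
      (Polynomial.X ^ (W - Finsupp.weight wt m) * ∏ x ∈ m.support, Y x ^ m x)
    have hEb0 : ∀ a < k, ∀ j, (Eb a j).eval 0 = E a j := by
      intro a ha j
      simp only [Eb]
      split_ifs with h1 h2
      · rw [hE0 a ha j (lt_of_lt_of_le h1 (hcc' a))]; simp
      · have := hw h2
        rw [hE0 a ha j h2, Polynomial.eval_pow, Polynomial.eval_X, zero_pow (by omega)]
      · simp
    have hU0 : ∀ j ∈ S, (U j).eval 0 ≠ 0 := by
      intro j hj
      obtain ⟨hk0, hc0⟩ := hadm m0 hm0 0 (i, j) ((hSmem j).1 hj)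
      simp only at hc0
      -- the index a
      have hex : ∃ a, a < k ∧ c a ≤ j ∧ (a + 1 < k → j < c (a + 1)) := by
        let G := (Finset.range k).filter (fun a => c a ≤ j)
        have hG : G.Nonempty := ⟨0, by simp [G, hk0, hc0]⟩
        have hmm := G.max'_mem hG
        refine ⟨G.max' hG, ?_, ?_, ?_⟩
        · exact Finset.mem_range.1 (Finset.mem_filter.1 hmm).1
        · exact (Finset.mem_filter.1 hmm).2
        · intro h1
          by_contra h2
          have := G.le_max' (G.max' hG + 1) (Finset.mem_filter.2 ⟨Finset.mem_range.2 h1, by omega⟩)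
          omega
      obtain ⟨a, hak, haj, haj'⟩ := hex
      have hjc' := hSc' a j hj haj haj'
      rw [Polynomial.eval_finsetSum, Finset.sum_eq_single a]
      · rw [if_neg (by omega)]
        split_ifs with h1
        · simp
        · have : j = c' a := by omega
          subst this
          simpa using hE1 a hak
      · intro b hb hba
        rw [Finset.mem_range] at hb
        rcases lt_or_gt_of_ne hba with hlt | hgt
        · have h1 := hc'c b (by omega)
          have h2 : c (b + 1) ≤ c a := by
            rcases Nat.lt_or_ge (b + 1) a with h | h
            · exact (hc _ _ h hak).le
            · have : b + 1 = a := by omega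
              rw [this]
          have h3 := hcc' b
          have h4 := hw (show c' b < j by omega)
          rw [if_neg (by omega), if_neg (by omega), Polynomial.eval_mul, Polynomial.eval_pow,
            Polynomial.eval_X, zero_pow (by omega), zero_mul]
        · have h1 : j < c b := by
            have h2 := haj' (by omega)
            rcases Nat.lt_or_ge (a + 1) b with h | h
            · have := hc _ _ h hb; omega
            · have : a + 1 = b := by omega
              rw [← this]; exact h2
          rw [if_pos h1, Polynomial.eval_zero]
      · intro h; exact absurd (Finset.mem_range.2 hak) h
    have hh0 : h.eval 0 = eval (fun x => (Y x).eval 0) fW := by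
      rw [hfW, weightedHomogeneousComponent_apply, map_sum, Finset.sum_filter,
        Polynomial.eval_finsetSum]
      refine Finset.sum_congr rfl fun m hm => ?_
      rw [Polynomial.eval_mul, Polynomial.eval_mul, Polynomial.eval_C, Polynomial.eval_pow,
          Polynomial.eval_X, Polynomial.eval_prod]
      split_ifs with h1
      · rw [h1, eval_monomial, tsub_self, pow_zero, one_mul, Finsupp.prod]
        simp only [Polynomial.eval_pow]
      · have := hmax m hm
        rw [zero_pow (by omega), zero_mul, mul_zero]
    have hh0' : h.eval 0 ≠ 0 := by
      rw [hh0, hfWg, map_mul]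
      refine mul_ne_zero ?_ ?_
      · rw [eval_monomial, one_mul, Finsupp.prod]
        refine Finset.prod_ne_zero_iff.2 fun x hx => pow_ne_zero _ ?_
        have h1 : x.1 = i := by
          simp only [hN, Finsupp.support_filter, Finset.mem_filter] at hx
          exact hx.2
        simp only [Y, if_pos h1]
        exact hU0 _ (Finset.mem_image_of_mem _ hx)
      · have : eval (fun x => (Y x).eval 0) g =
            eval (fun x => ∑ a ∈ Finset.range k, A x.1 a * E a x.2) g := by
          rw [eval_eq, eval_eq]
          refine Finset.sum_congr rfl fun p hp => ?_
          congr 1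
          refine Finset.prod_congr rfl fun x hx => ?_
          congr 1
          have h1 := hgrow p hp x hx
          simp only [Y, if_neg h1.ne, Polynomial.eval_finsetSum, Polynomial.eval_mul,
            Polynomial.eval_C]
          exact Finset.sum_congr rfl fun a ha => by rw [hEb0 a (Finset.mem_range.1 ha)]
        rw [this]; exact hev
    have hhX : Polynomial.X * h ≠ 0 := by
      refine mul_ne_zero Polynomial.X_ne_zero ?_
      intro h1; rw [h1] at hh0'; simp at hh0'
    obtain ⟨e, he⟩ := Polynomial.exists_eval_ne_zero_of_natDegree_lt_card _ hhX
      (lt_of_lt_of_le Cardinal.natCast_lt_aleph0 (Cardinal.aleph0_le_mk K))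
    rw [Polynomial.eval_mul, Polynomial.eval_X] at he
    have he0 : e ≠ 0 := left_ne_zero_of_mul he
    have heh : h.eval e ≠ 0 := right_ne_zero_of_mul he
    refine ⟨fun r a => if r = i then (e ^ w (c' a))⁻¹ else A r a, fun a j => (Eb a j).eval e, ?_, ?_, ?_⟩
    · intro a _ j hj; simp [Eb, hj]
    · intro a ha
      simp only [Eb, lt_irrefl, if_false]
      split_ifs with h1
      · simp [he0]
      · have h2 := hcc' a
        have : c a = c' a := by omega
        rw [this, Polynomial.eval_C]; exact hE1 a ha
    · have hP : ∀ x : ℕ × ℕ, ∑ a ∈ Finset.range k, (if x.1 = i then (e ^ w (c' a))⁻¹ else A x.1 a) *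
          (Eb a x.2).eval e = (e ^ wt x)⁻¹ * (Y x).eval e := by
        intro x
        by_cases hx : x.1 = i
        · simp only [hx, if_true, wt, Y, U, Polynomial.eval_finsetSum]
          rw [Finset.mul_sum]
          refine Finset.sum_congr rfl fun a _ => ?_
          simp only [Eb]
          split_ifs with h1 h2
          · simp
          · have := (hw h2).le
            rw [Polynomial.eval_pow, Polynomial.eval_X, pow_sub₀ _ he0 this]
            simp [he0]
          · have := hw.monotone (not_lt.1 h2)
            rw [Polynomial.eval_mul, Polynomial.eval_pow, Polynomial.eval_X, pow_sub₀ _ he0 this]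
            field_simp
        · simp [hx, wt, Y, Polynomial.eval_finsetSum]
      simp only [hP]
      intro hz
      apply heh
      have : h.eval e = e ^ W * eval (fun x => (e ^ wt x)⁻¹ * (Y x).eval e) f := by
        rw [eval_eq, Polynomial.eval_finsetSum, Finset.mul_sum]
        refine Finset.sum_congr rfl fun m hm => ?_
        rw [Polynomial.eval_mul, Polynomial.eval_mul, Polynomial.eval_C, Polynomial.eval_pow,
          Polynomial.eval_X, Polynomial.eval_prod, pow_sub₀ _ he0 (hmax m hm)]
        simp only [mul_pow, Finset.prod_mul_distrib, Polynomial.eval_pow]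
        have h1 : ∏ x ∈ m.support, ((e ^ wt x)⁻¹) ^ m x = (e ^ Finsupp.weight wt m)⁻¹ := by
          rw [Finsupp.weight_apply, Finsupp.sum, ← Finset.prod_pow_eq_pow_sum, ← Finset.prod_inv_distrib]
          refine Finset.prod_congr rfl fun x _ => ?_
          rw [inv_pow, ← pow_mul, smul_eq_mul, mul_comm]
        rw [h1]; ring
      rw [this, hz, mul_zero]

lemma ChainTo.le_snd {s : Set (ℕ × ℕ)} {a : ℕ} : ∀ {x : ℕ × ℕ}, ChainTo s a x → a ≤ x.2 := by
  induction a with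
  | zero => intro x _; omega
  | succ a ih => rintro x ⟨_, y, _, h2, h3⟩; have := ih h3; omega

lemma ChainTo.shorten {s : Set (ℕ × ℕ)} {a b : ℕ} (hab : b ≤ a) : ∀ {x : ℕ × ℕ},
    ChainTo s a x → ∃ y, ChainTo s b y := by
  induction a with
  | zero => intro x h; have : b = 0 := by omega
            subst this; exact ⟨x, h⟩
  | succ a ih =>
    intro x h
    rcases Nat.lt_or_ge b (a + 1) with h1 | h1
    · obtain ⟨_, y, _, _, h3⟩ := h
      exact ih (by omega) h3
    · have : b = a + 1 := by omega
      subst this; exact ⟨x, h⟩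

lemma ChainTo.exists_seq {s : Set (ℕ × ℕ)} {a : ℕ} : ∀ {x : ℕ × ℕ}, ChainTo s a x →
    ∃ p : ℕ → ℕ × ℕ, (∀ b ≤ a, p b ∈ s) ∧ p a = x ∧
      ∀ b b', b < b' → b' ≤ a → (p b).1 < (p b').1 ∧ (p b).2 < (p b').2 := by
  induction a with
  | zero =>
    intro x h
    exact ⟨fun _ => x, fun _ _ => h, rfl, fun b b' h1 h2 => by omega⟩
  | succ a ih =>
    rintro x ⟨hx, y, h1, h2, h3⟩
    obtain ⟨p, hp, hpa, hpm⟩ := ih h3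
    refine ⟨fun b => if b ≤ a then p b else x, ?_, by simp, ?_⟩
    · intro b _
      dsimp only
      split_ifs with h
      · exact hp b h
      · exact hx
    · intro b b' hbb hb'
      dsimp only
      rw [if_pos (show b ≤ a by omega)]
      split_ifs with h
      · exact hpm b b' hbb h
      · rcases Nat.lt_or_ge b a with h' | h'
        · have := hpm b a h' le_rfl
          rw [hpa] at this
          omega
        · have : b = a := by omega
          subst this
          rw [hpa]; exact ⟨h1, h2⟩

/-- embedding of the ladder variables into `ℕ × ℕ` -/
def ladEmb {r n : ℕ} {L : Set (Fin r × Fin n)} (x : L) : ℕ × ℕ := ((x.1.1 : ℕ), (x.1.2 : ℕ))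

lemma ladEmb_injective {r n : ℕ} {L : Set (Fin r × Fin n)} :
    Function.Injective (ladEmb : L → ℕ × ℕ) := by
  rintro ⟨⟨a, b⟩, h⟩ ⟨⟨a', b'⟩, h'⟩ he
  simp only [ladEmb, Prod.mk.injEq] at he
  have h1 := Fin.ext he.1
  have h2 := Fin.ext he.2
  subst h1 h2
  rfl

theorem star_lad {K : Type*} [Field K] [Infinite K] {r n : ℕ} {L : Set (Fin r × Fin n)} (k : ℕ)
    (f : MvPolynomial L K) (hf : f ≠ 0)
    (hs : ∀ m ∈ f.support, ∀ x, ¬ ChainTo (ladEmb '' (m.support : Set L)) k x) :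
    ∃ (A : ℕ → ℕ → K) (E : ℕ → ℕ → K),
      eval (fun x : L => ∑ a ∈ Finset.range k, A x.1.1 a * E a x.1.2) f ≠ 0 := by
  classical
  have hsupp : ∀ m' ∈ (rename ladEmb f).support, ∃ m ∈ f.support,
      (m'.support : Set (ℕ × ℕ)) ⊆ ladEmb '' (m.support : Set L) := by
    intro m' hm'
    rw [support_rename_of_injective ladEmb_injective, Finset.mem_image] at hm'
    obtain ⟨m, hm, rfl⟩ := hm'
    refine ⟨m, hm, ?_⟩
    have := Finsupp.mapDomain_support (f := (ladEmb : L → ℕ × ℕ)) (s := m)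
    intro x hx
    have := this hx
    simpa using this
  obtain ⟨A, E, -, -, h⟩ := star_aux (K := K) k r (fun a => a) (fun a b h _ => h) (rename ladEmb f)
    (by
      intro h
      exact hf (rename_injective _ ladEmb_injective (by rw [h, map_zero])))
    (by
      intro m' hm' x hx
      obtain ⟨m, hm, hsub⟩ := hsupp m' hm'
      obtain ⟨y, _, rfl⟩ := hsub hx
      exact y.1.1.2)
    (by
      intro m' hm' a x hx
      obtain ⟨m, hm, hsub⟩ := hsupp m' hm'
      refine ⟨?_, hx.le_snd⟩
      by_contra h
      obtain ⟨y, hy⟩ := (hx.mono hsub).shorten (not_lt.1 h)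
      exact hs m hm y hy)
  refine ⟨A, E, ?_⟩
  rw [eval_rename] at h
  exact h

/-- generic parametrization with summands indexed by `T` -/
noncomputable def param (K : Type*) [Field K] {r n : ℕ} (L : Set (Fin r × Fin n)) {κ : Type*} (T : Finset κ) :
    MvPolynomial L K →ₐ[K] MvPolynomial ((Fin r × κ) ⊕ (κ × Fin n)) K :=
  aeval fun x => ∑ a ∈ T, X (Sum.inl (x.1.1, a)) * X (Sum.inr (a, x.1.2))

lemma eval_param {K : Type*} [Field K] {r n : ℕ} (L : Set (Fin r × Fin n)) {κ : Type*} (T : Finset κ)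
    (pt : (Fin r × κ) ⊕ (κ × Fin n) → K) (f : MvPolynomial L K) :
    eval pt (param K L T f) =
      eval (fun x : L => ∑ a ∈ T, pt (Sum.inl (x.1.1, a)) * pt (Sum.inr (a, x.1.2))) f := by
  have : (aeval pt : MvPolynomial _ K →ₐ[K] K).comp (param K L T) =
      aeval (fun x : L => ∑ a ∈ T, pt (Sum.inl (x.1.1, a)) * pt (Sum.inr (a, x.1.2))) := by
    ext x
    simp [param]
  simpa [aeval_eq_eval] using congrArg (fun φ => φ f) this

theorem star_param {K : Type*} [Field K] [Infinite K] {r n : ℕ} {L : Set (Fin r × Fin n)}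
    {κ : Type*} (T : Finset κ)
    (f : MvPolynomial L K) (hf : f ≠ 0)
    (hs : ∀ m ∈ f.support, ∀ x, ¬ ChainTo (ladEmb '' (m.support : Set L)) T.card x) :
    param K L T f ≠ 0 := by
  classical
  obtain ⟨A, E, h⟩ := star_lad T.card f hf hs
  let e := T.equivFin
  let ix : κ → ℕ := fun a => if h : a ∈ T then (e ⟨a, h⟩ : ℕ) else 0
  intro h0
  apply h
  have := eval_param L T (Sum.elim (fun p => A p.1 (ix p.2)) (fun p => E (ix p.1) p.2)) f
  rw [h0, map_zero] at this
  rw [this]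
  congr 2
  ext x
  simp only [Sum.elim_inl, Sum.elim_inr]
  rw [← Finset.sum_attach T, Finset.sum_range]
  refine (Fintype.sum_equiv e.symm _ (fun a => A x.1.1 (e a) * E (e a) x.1.2)
    (fun a => by simp)).trans ?_
  · rw [Finset.univ_eq_attach]
    refine Finset.sum_congr rfl fun a _ => ?_
    simp [ix, a.2]

lemma det_mul_of_card_lt' {D : Type*} [CommRing D] [IsDomain D] {ι κ : Type*} [Fintype ι] [DecidableEq ι]
    [Fintype κ] (h : Fintype.card κ < Fintype.card ι) (M1 : Matrix ι κ D) (M2 : Matrix κ ι D) :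
    (M1 * M2).det = 0 := by
  have h1 : ¬ Function.Injective M2.mulVecLin := by
    intro hi
    have := card_le_of_injective D M2.mulVecLin hi
    omega
  rw [← LinearMap.ker_eq_bot, Submodule.eq_bot_iff] at h1
  push Not at h1
  obtain ⟨v, hv, hv0⟩ := h1
  refine Matrix.exists_mulVec_eq_zero_iff.1 ⟨v, hv0, ?_⟩
  rw [LinearMap.mem_ker, Matrix.mulVecLin_apply] at hv
  rw [← Matrix.mulVec_mulVec, hv, Matrix.mulVec_zero]

lemma exists_minor {r n : ℕ} {L : Set (Fin r × Fin n)}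
    (hladder : ∀ (i p : Fin r) (j q : Fin n),
      (i, j) ∈ L → (p, q) ∈ L → i < p → j < q → (i, q) ∈ L ∧ (p, j) ∈ L)
    {s : Set L} {a : ℕ} {x : ℕ × ℕ} (hx : ChainTo (ladEmb '' s) a x) :
    ∃ (ri : Fin (a + 1) → Fin r) (ci : Fin (a + 1) → Fin n) (h : ∀ b b', (ri b, ci b') ∈ L),
      StrictMono ri ∧ StrictMono ci ∧ ∀ b, (⟨(ri b, ci b), h b b⟩ : L) ∈ s := by
  obtain ⟨p, hp, -, hpm⟩ := hx.exists_seq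
  have : Nonempty L := by
    obtain ⟨q, -⟩ := hp 0 (Nat.zero_le _)
    exact ⟨q⟩
  choose! q hq using hp
  let ri : Fin (a + 1) → Fin r := fun b => (q b).1.1
  let ci : Fin (a + 1) → Fin n := fun b => (q b).1.2
  have hr : StrictMono ri := by
    intro b b' hbb
    have := (hpm b b' hbb (by omega)).1
    rw [← (hq b (by omega)).2, ← (hq b' (by omega)).2] at this
    exact this
  have hc : StrictMono ci := by
    intro b b' hbb
    have := (hpm b b' hbb (by omega)).2
    rw [← (hq b (by omega)).2, ← (hq b' (by omega)).2] at this
    exact this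
  have hd : ∀ b, (ri b, ci b) ∈ L := fun b => (q b).2
  refine ⟨ri, ci, ?_, hr, hc, fun b => (hq b (by omega)).1⟩
  intro b b'
  rcases lt_trichotomy b b' with h | h | h
  · exact (hladder _ _ _ _ (hd b) (hd b') (hr h) (hc h)).1
  · subst h; exact hd b
  · exact (hladder _ _ _ _ (hd b') (hd b) (hr h) (hc h)).2

noncomputable def ladIdeal (K : Type*) [Field K] {r n : ℕ} (L : Set (Fin r × Fin n)) (t : ℕ) :
    Ideal (MvPolynomial L K) := Ideal.span {d |
      ∃ (ri : Fin t → Fin r) (ci : Fin t → Fin n) (h : ∀ a b, (ri a, ci b) ∈ L),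
        Function.Injective ri ∧ Function.Injective ci ∧
        d = Matrix.det (Matrix.of fun a b =>
          (MvPolynomial.X ⟨(ri a, ci b), h a b⟩ : MvPolynomial L K))}

/-- reducible to a combination of standard monomials modulo the ideal -/
def Red (K : Type*) [Field K] {r n : ℕ} (L : Set (Fin r × Fin n)) (k : ℕ) (f : MvPolynomial L K) :
    Prop :=
  ∃ f' : MvPolynomial L K, f - f' ∈ ladIdeal K L (k + 1) ∧
    ∀ m ∈ f'.support, ∀ x, ¬ ChainTo (ladEmb '' (m.support : Set L)) k x

section
variable {K : Type*} [Field K] {r n : ℕ} {L : Set (Fin r × Fin n)} {k : ℕ}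

lemma Red.add {f g : MvPolynomial L K} (hf : Red K L k f) (hg : Red K L k g) : Red K L k (f + g) := by
  classical
  obtain ⟨f', h1, h2⟩ := hf
  obtain ⟨g', h3, h4⟩ := hg
  refine ⟨f' + g', ?_, ?_⟩
  · have := Ideal.add_mem _ h1 h3
    convert this using 1; ring
  · intro m hm
    rcases Finset.mem_union.1 (support_add hm) with h | h
    · exact h2 m h
    · exact h4 m h

lemma Red.C_mul {f : MvPolynomial L K} (hf : Red K L k f) (c : K) : Red K L k (C c * f) := by
  classical
  obtain ⟨f', h1, h2⟩ := hf
  refine ⟨C c * f', ?_, ?_⟩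
  · rw [← mul_sub]; exact Ideal.mul_mem_left _ _ h1
  · intro m hm
    refine h2 m ?_
    rw [mem_support_iff, coeff_C_mul] at hm
    exact mem_support_iff.2 (right_ne_zero_of_mul hm)

lemma Red.sum {ι : Type*} (s : Finset ι) (F : ι → MvPolynomial L K)
    (h : ∀ i ∈ s, Red K L k (F i)) : Red K L k (∑ i ∈ s, F i) := by
  classical
  induction s using Finset.induction_on with
  | empty => exact ⟨0, by simp, by simp⟩
  | insert a s ha ih =>
    rw [Finset.sum_insert ha]
    exact (h a (Finset.mem_insert_self _ _)).add (ih fun i hi => h i (Finset.mem_insert_of_mem hi))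

lemma Red.of_mem {f : MvPolynomial L K} (h : f ∈ ladIdeal K L (k + 1)) : Red K L k f :=
  ⟨0, by simpa using h, by simp⟩

lemma red_monomial
    (hladder : ∀ (i p : Fin r) (j q : Fin n),
      (i, j) ∈ L → (p, q) ∈ L → i < p → j < q → (i, q) ∈ L ∧ (p, j) ∈ L) :
    ∀ (N : ℕ) (m : L →₀ ℕ), Finsupp.weight (fun x : L => (x.1.1 : ℕ) * (x.1.2 : ℕ)) m = N →
      Red K L k (monomial m 1) := by
  classical
  intro N
  induction N using Nat.strong_induction_on with
  | _ N ih =>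
  intro m hmN
  by_cases hstd : ∀ x, ¬ ChainTo (ladEmb '' (m.support : Set L)) k x
  · refine ⟨monomial m 1, by simp, ?_⟩
    intro m' hm'
    have : m' = m := by simpa using support_monomial_subset hm'
    rw [this]; exact hstd
  · push Not at hstd
    obtain ⟨x, hx⟩ := hstd
    obtain ⟨ri, ci, h, hr, hc, hmem⟩ := exists_minor hladder hx
    let d : Equiv.Perm (Fin (k + 1)) → (L →₀ ℕ) := fun σ =>
      ∑ b, Finsupp.single (⟨(ri (σ b), ci b), h _ _⟩ : L) 1
    have hdm : d 1 ≤ m := by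
      intro y
      simp only [d, Finsupp.coe_finsetSum, Finset.sum_apply, Equiv.Perm.one_apply]
      by_cases hy : ∃ b, (⟨(ri b, ci b), h b b⟩ : L) = y
      · obtain ⟨b, rfl⟩ := hy
        rw [Finset.sum_eq_single b]
        · have := hmem b
          simp only [Finset.mem_coe, Finsupp.mem_support_iff] at this
          simp; omega
        · intro b' _ hb
          rw [Finsupp.single_eq_of_ne]
          intro he
          apply hb
          have := congrArg (fun z : L => z.1.1) he
          exact (hr.injective this).symm
        · simp
      · rw [Finset.sum_eq_zero]
        · omega
        · intro b _
          rw [Finsupp.single_eq_of_ne]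
          intro he; exact hy ⟨b, he.symm⟩
    have hprod : ∀ σ, ∏ b, (X (⟨(ri (σ b), ci b), h _ _⟩ : L) : MvPolynomial L K) = monomial (d σ) 1 := by
      intro σ
      simp only [d]
      rw [monomial_sum_one]
      rfl
    have hdet := Matrix.det_apply (Matrix.of fun a b =>
          (MvPolynomial.X ⟨(ri a, ci b), h a b⟩ : MvPolynomial L K))
    simp only [Matrix.of_apply, hprod] at hdet
    rw [← Finset.add_sum_erase _ _ (Finset.mem_univ 1), Equiv.Perm.sign_one, one_smul] at hdet
    have hm : monomial m (1 : K) = monomial (m - d 1) 1 * monomial (d 1) 1 := by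
      rw [monomial_mul, tsub_add_cancel_of_le hdm, one_mul]
    rw [eq_sub_of_add_eq hdet.symm, mul_sub, sub_eq_add_neg, Finset.mul_sum, ← Finset.sum_neg_distrib] at hm
    rw [hm]
    refine Red.add (Red.of_mem ?_) (Red.sum _ _ ?_)
    · exact Ideal.mul_mem_left _ _ (Ideal.subset_span ⟨ri, ci, h, hr.injective, hc.injective, rfl⟩)
    · intro σ hσ
      have hσ1 : σ ≠ 1 := (Finset.mem_erase.1 hσ).1
      have hwt : ∀ σ, Finsupp.weight (fun x : L => (x.1.1 : ℕ) * (x.1.2 : ℕ)) (d σ) =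
          ∑ b, (ri (σ b) : ℕ) * (ci b : ℕ) := by
        intro σ
        simp only [d, map_sum]
        refine Finset.sum_congr rfl fun b _ => ?_
        rw [Finsupp.weight_single]; simp
      have hlt : Finsupp.weight (fun x : L => (x.1.1 : ℕ) * (x.1.2 : ℕ)) (d σ) <
          Finsupp.weight (fun x : L => (x.1.1 : ℕ) * (x.1.2 : ℕ)) (d 1) := by
        rw [hwt, hwt]
        have hmono : Monovary (fun b => (ci b : ℕ)) (fun b => (ri b : ℕ)) := by
          intro b b' hb
          have : b < b' := hr.lt_iff_lt.1 hb
          exact (hc this).le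
        have := (Monovary.sum_mul_comp_perm_lt_sum_mul_iff (σ := σ) hmono).2 ?_
        · simpa [mul_comm] using this
        · intro hmv
          apply hσ1
          have h1 : Monotone σ := by
            intro b b' hbb
            by_contra hlt
            push Not at hlt
            have h2 := hmv (i := b') (j := b) (by simpa using hr hlt)
            have h3 : ci b ≤ ci b' := hc.monotone hbb
            have h4 : ci b = ci b' := le_antisymm h3 h2
            rw [hc.injective h4] at hlt
            exact lt_irrefl _ hlt
          have h2 : StrictMono σ := h1.strictMono_of_injective σ.injective
          ext b
          have := Subsingleton.elim (h2.orderIsoOfSurjective σ σ.surjective) (OrderIso.refl _)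
          have := congrArg (fun e => e b) this
          simpa using congrArg Fin.val this
      have : -(monomial (m - d 1) (1:K) * (Equiv.Perm.sign σ • monomial (d σ) (1:K))) =
          C (-(((Equiv.Perm.sign σ : ℤˣ) : ℤ) : K)) * monomial (m - d 1 + d σ) 1 := by
        rw [Units.smul_def, zsmul_eq_mul]
        have : monomial (m - d 1 + d σ) (1:K) = monomial (m - d 1) 1 * monomial (d σ) 1 := by
          rw [monomial_mul, one_mul]
        rw [this]
        simp only [map_neg, map_intCast]
        ring
      rw [this]
      refine Red.C_mul (ih _ ?_ _ rfl) _
      rw [← hmN]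
      conv_rhs => rw [← tsub_add_cancel_of_le hdm]
      rw [map_add, map_add]
      omega

lemma red_all
    (hladder : ∀ (i p : Fin r) (j q : Fin n),
      (i, j) ∈ L → (p, q) ∈ L → i < p → j < q → (i, q) ∈ L ∧ (p, j) ∈ L) (f : MvPolynomial L K) :
    Red K L k f := by
  rw [f.as_sum]
  refine Red.sum _ _ fun m _ => ?_
  have : monomial m (coeff m f) = C (coeff m f) * monomial m 1 := by
    rw [C_mul_monomial, mul_one]
  rw [this]
  exact (red_monomial hladder _ m rfl).C_mul _

lemma param_minor {κ : Type*} (T : Finset κ) {t : ℕ} (hT : T.card < t) (ri : Fin t → Fin r)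
    (ci : Fin t → Fin n) (h : ∀ a b, (ri a, ci b) ∈ L) :
    param K L T (Matrix.det (Matrix.of fun a b =>
          (MvPolynomial.X ⟨(ri a, ci b), h a b⟩ : MvPolynomial L K))) = 0 := by
  rw [AlgHom.map_det]
  let M1 : Matrix (Fin t) T (MvPolynomial ((Fin r × κ) ⊕ (κ × Fin n)) K) :=
    Matrix.of fun a c => X (Sum.inl (ri a, c.1))
  let M2 : Matrix T (Fin t) (MvPolynomial ((Fin r × κ) ⊕ (κ × Fin n)) K) :=
    Matrix.of fun c b => X (Sum.inr (c.1, ci b))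
  have : (param K L T).mapMatrix (Matrix.of fun a b =>
          (MvPolynomial.X ⟨(ri a, ci b), h a b⟩ : MvPolynomial L K)) = M1 * M2 := by
    ext1 a b
    simp only [AlgHom.mapMatrix_apply, Matrix.map_apply, Matrix.of_apply, Matrix.mul_apply, M1, M2, param,
      aeval_X]
    rw [← Finset.sum_attach T, Finset.univ_eq_attach]
  rw [this]
  exact det_mul_of_card_lt' (by simpa using hT) M1 M2

theorem ladIdeal_eq_ker [Infinite K]
    (hladder : ∀ (i p : Fin r) (j q : Fin n),
      (i, j) ∈ L → (p, q) ∈ L → i < p → j < q → (i, q) ∈ L ∧ (p, j) ∈ L)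
    {κ : Type*} (T : Finset κ) (hT : T.card = k) :
    ladIdeal K L (k + 1) = RingHom.ker (param K L T) := by
  have hle : ladIdeal K L (k + 1) ≤ RingHom.ker (param K L T) := by
    refine Ideal.span_le.2 ?_
    rintro d ⟨ri, ci, h, -, -, rfl⟩
    exact param_minor T (by omega) ri ci h
  refine le_antisymm hle ?_
  intro f hf
  obtain ⟨f', h1, h2⟩ := red_all (k := k) hladder f
  by_cases h0 : f' = 0
  · simpa [h0] using h1
  · exfalso
    refine star_param T f' h0 (by rw [hT]; exact h2) ?_
    have h3 : param K L T (f - f') = 0 := hle h1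
    have h4 : param K L T f = 0 := hf
    rw [map_sub, h4, zero_sub, neg_eq_zero] at h3
    exact h3

end

section
variable {R : Type*} [CommRing R]

lemma mem_symbolicPower_iff [IsNoetherianRing R] {I : Ideal R} (hI : I.IsPrime) (s : ℕ) (f : R) :
    f ∈ symbolicPower I s ↔ ∃ g, g ∉ I ∧ g * f ∈ I ^ s := by
  have hass : associatedPrimes R (R ⧸ I) = {I} := by
    rw [associatedPrimes.eq_singleton_of_isPrimary hI.isPrimary, hI.radical]
  unfold symbolicPower
  rw [Submodule.mem_iInf]
  constructor
  · intro h
    have := h ⟨I, by rw [hass]; rfl⟩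
    rw [Ideal.mem_comap, IsLocalization.algebraMap_mem_map_algebraMap_iff I.primeCompl] at this
    obtain ⟨g, hg, h⟩ := this
    exact ⟨g, hg, h⟩
  · rintro ⟨g, hg, h⟩ ⟨p, hp⟩
    have hpI : p = I := by rw [hass] at hp; exact hp
    subst hpI
    rw [Ideal.mem_comap, IsLocalization.algebraMap_mem_map_algebraMap_iff p.primeCompl]
    exact ⟨g, hg, h⟩

lemma det_mem_pow {I : Ideal R} {ι : Type*} [Fintype ι] [DecidableEq ι] (M : Matrix ι ι R)
    (h : ∀ a b, M a b ∈ I) : M.det ∈ I ^ Fintype.card ι := by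
  rw [Matrix.det_apply]
  refine Ideal.sum_mem _ fun σ _ => ?_
  rw [Units.smul_def, zsmul_eq_mul]
  refine Ideal.mul_mem_left _ _ ?_
  have := Ideal.prod_mem_prod (s := Finset.univ) (I := fun _ : ι => I) (x := fun b => M (σ b) b)
    (fun b _ => h _ _)
  simpa using this

lemma schur_mul {ι κ : Type*} [Fintype ι] [DecidableEq ι] [Fintype κ] [DecidableEq κ]
    (A : Matrix ι ι R) (B : Matrix ι κ R) (C' : Matrix κ ι R) (D : Matrix κ κ R) :
    (Matrix.fromBlocks A B C' D).det * A.det ^ Fintype.card κ =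
      A.det * (A.det • D - C' * A.adjugate * B).det := by
  have h1 : Matrix.fromBlocks A B C' D * Matrix.fromBlocks 1 (-(A.adjugate * B)) 0 (A.det • 1) =
      Matrix.fromBlocks A 0 C' (A.det • D - C' * A.adjugate * B) := by
    rw [Matrix.fromBlocks_multiply]
    congr 1
    · simp
    · rw [Matrix.mul_neg, ← Matrix.mul_assoc, Matrix.mul_adjugate]; simp
    · simp
    · rw [Matrix.mul_neg, ← Matrix.mul_assoc]; simp [sub_eq_add_neg, add_comm]
  have := congrArg Matrix.det h1
  rw [Matrix.det_mul, Matrix.det_fromBlocks_zero₂₁, Matrix.det_fromBlocks_zero₁₂] at this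
  simpa using this

/-- bordered minors in the prime `I` force the big determinant into the symbolic power -/
lemma big_minor {I : Ideal R} (hI : I.IsPrime) {ι κ : Type*} [Fintype ι] [DecidableEq ι]
    [Fintype κ] [DecidableEq κ] (M : Matrix (ι ⊕ κ) (ι ⊕ κ) R) (hA : M.toBlocks₁₁.det ∉ I)
    (hM : ∀ a b : κ, (M.submatrix (Sum.map id fun _ : Unit => a) (Sum.map id fun _ : Unit => b)).det ∈ I) :
    ∃ g, g ∉ I ∧ g * M.det ∈ I ^ Fintype.card κ := by
  refine ⟨M.toBlocks₁₁.det ^ Fintype.card κ, fun h => hA (hI.mem_of_pow_mem _ h), ?_⟩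
  have h0 := schur_mul M.toBlocks₁₁ M.toBlocks₁₂ M.toBlocks₂₁ M.toBlocks₂₂
  rw [Matrix.fromBlocks_toBlocks] at h0
  rw [mul_comm, h0]
  refine Ideal.mul_mem_left _ _ (det_mem_pow _ ?_)
  intro a b
  have h1 := schur_mul M.toBlocks₁₁ (M.toBlocks₁₂.submatrix id (fun _ : Unit => b))
    (M.toBlocks₂₁.submatrix (fun _ : Unit => a) id) (M.toBlocks₂₂.submatrix (fun _ : Unit => a) (fun _ : Unit => b))
  have h2 : Matrix.fromBlocks M.toBlocks₁₁ (M.toBlocks₁₂.submatrix id (fun _ : Unit => b))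
    (M.toBlocks₂₁.submatrix (fun _ : Unit => a) id) (M.toBlocks₂₂.submatrix (fun _ : Unit => a) (fun _ : Unit => b)) =
    M.submatrix (Sum.map id fun _ : Unit => a) (Sum.map id fun _ : Unit => b) := by
    ext x y
    rcases x with x | x <;> rcases y with y | y <;> rfl
  rw [h2] at h1
  have h3 := Ideal.mul_mem_right (M.toBlocks₁₁.det ^ Fintype.card Unit) I (hM a b)
  rw [h1] at h3
  have h4 := (hI.mem_or_mem h3).resolve_left hA
  rw [Matrix.det_unique] at h4
  exact h4

end

section
variable {K : Type*} [Field K] {r n : ℕ} {L : Set (Fin r × Fin n)} {k : ℕ}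

/-- the generic minor, on arbitrary index types -/
noncomputable def gmin (K : Type*) [Field K] (L : Set (Fin r × Fin n)) {ι : Type*} [Fintype ι] [DecidableEq ι]
    (ri : ι → Fin r) (ci : ι → Fin n) (h : ∀ a b, (ri a, ci b) ∈ L) : MvPolynomial L K :=
  Matrix.det (Matrix.of fun a b => (MvPolynomial.X ⟨(ri a, ci b), h a b⟩ : MvPolynomial L K))

lemma gmin_hom {ι : Type*} [Fintype ι] [DecidableEq ι]
    (ri : ι → Fin r) (ci : ι → Fin n) (h : ∀ a b, (ri a, ci b) ∈ L) :
    (gmin K L ri ci h).IsHomogeneous (Fintype.card ι) := by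
  unfold gmin
  rw [Matrix.det_apply]
  refine IsHomogeneous.sum _ _ _ fun σ _ => ?_
  rw [Units.smul_def, zsmul_eq_mul]
  have h1 : (∏ i, (Matrix.of fun a b => (MvPolynomial.X ⟨(ri a, ci b), h a b⟩ : MvPolynomial L K)) (σ i) i).IsHomogeneous
      (∑ i : ι, 1) := IsHomogeneous.prod _ _ _ fun i _ => isHomogeneous_X _ _
  have h2 : ((((Equiv.Perm.sign σ : ℤˣ) : ℤ) : MvPolynomial L K)).IsHomogeneous 0 := by
    have := isHomogeneous_C L ((((Equiv.Perm.sign σ : ℤˣ) : ℤ) : K))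
    rwa [map_intCast] at this
  simpa using h2.mul h1

lemma gmin_param_ne {κ : Type*} [DecidableEq κ] (T : Finset κ) {ι : Type*} [Fintype ι] [DecidableEq ι]
    (hT : T.card = Fintype.card ι)
    (ri : ι → Fin r) (ci : ι → Fin n) (h : ∀ a b, (ri a, ci b) ∈ L)
    (hr : Function.Injective ri) (hc : Function.Injective ci) :
    param K L T (gmin K L ri ci h) ≠ 0 := by
  classical
  have e : ι ≃ T := Fintype.equivOfCardEq (by simpa using hT.symm)
  intro h0
  have h1 := eval_param L T (Sum.elim
    (fun p : Fin r × κ => if ∃ a, ri a = p.1 ∧ (e a : κ) = p.2 then (1 : K) else 0)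
    (fun p : κ × Fin n => if ∃ a, ci a = p.2 ∧ (e a : κ) = p.1 then (1 : K) else 0)) (gmin K L ri ci h)
  rw [h0, map_zero] at h1
  have h2 : ∀ a b : ι, (∑ c ∈ T, (if ∃ a', ri a' = ri a ∧ (e a' : κ) = c then (1 : K) else 0) *
      (if ∃ a', ci a' = ci b ∧ (e a' : κ) = c then (1 : K) else 0)) = if a = b then 1 else 0 := by
    intro a b
    rw [Finset.sum_eq_single (e a : κ)]
    · rw [if_pos ⟨a, rfl, rfl⟩, one_mul]
      congr 1
      apply propext
      constructor
      · rintro ⟨a', h1, h2⟩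
        have := e.injective (Subtype.ext h2)
        rw [← this]; exact hc h1
      · rintro rfl; exact ⟨a, rfl, rfl⟩
    · intro c _ hca
      rw [if_neg, zero_mul]
      rintro ⟨a', h1, h2⟩
      rw [hr h1] at h2
      exact hca h2.symm
    · intro h; exact absurd (e a).2 h
  unfold gmin at h1
  rw [RingHom.map_det] at h1
  have h3 : ∀ P : L → K, (∀ a b, P ⟨(ri a, ci b), h a b⟩ = if a = b then 1 else 0) →
      (eval P).mapMatrix (Matrix.of fun a b => (MvPolynomial.X ⟨(ri a, ci b), h a b⟩ : MvPolynomial L K)) = 1 := by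
    intro P hP
    ext a b
    simp [hP, Matrix.one_apply]
  rw [h3 _ (by intro a b; simpa using h2 a b)] at h1
  simp at h1

lemma ladIdeal_prime [Infinite K]
    (hladder : ∀ (i p : Fin r) (j q : Fin n),
      (i, j) ∈ L → (p, q) ∈ L → i < p → j < q → (i, q) ∈ L ∧ (p, j) ∈ L) :
    (ladIdeal K L (k + 1)).IsPrime := by
  rw [ladIdeal_eq_ker hladder (Finset.univ : Finset (Fin k)) (by simp)]
  exact RingHom.ker_isPrime _

/-- a minor of size `k + q` lies in the `q`-th symbolic power -/
lemma gmin_symb [Infinite K]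
    (hladder : ∀ (i p : Fin r) (j q : Fin n),
      (i, j) ∈ L → (p, q) ∈ L → i < p → j < q → (i, q) ∈ L ∧ (p, j) ∈ L) {q : ℕ}
    (ri : Fin k ⊕ Fin q → Fin r) (ci : Fin k ⊕ Fin q → Fin n) (h : ∀ a b, (ri a, ci b) ∈ L)
    (hr : Function.Injective ri) (hc : Function.Injective ci) :
    ∃ g, g ∉ ladIdeal K L (k + 1) ∧ g * gmin K L ri ci h ∈ ladIdeal K L (k + 1) ^ q := by
  classical
  have := big_minor (ladIdeal_prime (K := K) (k := k) hladder)
    (Matrix.of fun a b => (MvPolynomial.X ⟨(ri a, ci b), h a b⟩ : MvPolynomial L K)) ?_ ?_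
  · simpa [gmin] using this
  · rw [ladIdeal_eq_ker hladder (Finset.univ : Finset (Fin k)) (by simp)]
    exact gmin_param_ne (K := K) (L := L) (Finset.univ : Finset (Fin k)) (by simp) (ri ∘ Sum.inl) (ci ∘ Sum.inl)
      (fun _ _ => h _ _) (hr.comp Sum.inl_injective) (hc.comp Sum.inl_injective)
  · intro a b
    have hinj : ∀ a : Fin q, Function.Injective (Sum.map id (fun _ : Unit => a) : Fin k ⊕ Unit → Fin k ⊕ Fin q) := by
      intro a
      exact Function.Injective.sumMap Function.injective_id (fun _ _ _ => rfl)
    let e : Fin k ⊕ Unit ≃ Fin (k + 1) := Fintype.equivOfCardEq (by simp)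
    refine Ideal.subset_span ⟨ri ∘ Sum.map id (fun _ : Unit => a) ∘ e.symm, ci ∘ Sum.map id (fun _ : Unit => b) ∘ e.symm, fun _ _ => h _ _,
      hr.comp ((hinj a).comp e.symm.injective), hc.comp ((hinj b).comp e.symm.injective), ?_⟩
    rw [← Matrix.det_submatrix_equiv_self e.symm]
    rfl

end

lemma exists_small_set {M : ℕ} (e : Fin M → ℕ) (q : ℕ) (hq : q ≤ M) :
    ∃ S : Finset (Fin M), S.card = q ∧ ∀ a ∈ S, ∀ b ∉ S, e a ≤ e b := by
  classical
  induction q with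
  | zero => exact ⟨∅, by simp, by simp⟩
  | succ q ih =>
    obtain ⟨S, hS, h⟩ := ih (by omega)
    have hne : (Sᶜ).Nonempty := by
      rw [← Finset.card_pos, Finset.card_compl, Fintype.card_fin]; omega
    obtain ⟨x, hx, hmin⟩ := Finset.exists_min_image Sᶜ e hne
    rw [Finset.mem_compl] at hx
    refine ⟨insert x S, by rw [Finset.card_insert_of_notMem hx, hS], ?_⟩
    intro a ha b hb
    rw [Finset.mem_insert, not_or] at hb
    rcases Finset.mem_insert.1 ha with rfl | ha
    · exact hmin b (Finset.mem_compl.2 hb.2)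
    · exact h a ha b hb.2

lemma comb_bound {M k q s : ℕ} (hkq : k + q = M) (e : Fin M → ℕ)
    (h : ∀ S : Finset (Fin M), S.card = q → s ≤ ∑ c ∈ S, e c) :
    ∃ N, s ≤ q * N ∧ s + k * N ≤ ∑ c, e c := by
  classical
  obtain ⟨S, hS, hle⟩ := exists_small_set e q (by omega)
  refine ⟨S.sup e, ?_, ?_⟩
  · refine (h S hS).trans ?_
    have := Finset.sum_le_card_nsmul S e (S.sup e) (fun x hx => Finset.le_sup hx)
    simpa [hS] using this
  · rw [← Finset.sum_add_sum_compl S e]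
    refine add_le_add (h S hS) ?_
    have := Finset.card_nsmul_le_sum Sᶜ e (S.sup e) (fun x hx =>
      Finset.sup_le fun a ha => hle a ha x (Finset.mem_compl.1 hx))
    rw [Finset.card_compl, Fintype.card_fin, hS, smul_eq_mul] at this
    have hk : M - q = k := by omega
    rwa [hk] at this

section
variable {K : Type*} [Field K] {r n : ℕ} {L : Set (Fin r × Fin n)} {k : ℕ}

set_option maxHeartbeats 2000000 in
theorem lower_bound [Infinite K]
    (hladder : ∀ (i p : Fin r) (j q : Fin n),
      (i, j) ∈ L → (p, q) ∈ L → i < p → j < q → (i, q) ∈ L ∧ (p, j) ∈ L) {M q s d : ℕ}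
    (hkq : k + q = M) (hM : ∀ (S : Set L) x, ¬ ChainTo (ladEmb '' S) M x)
    (f g : MvPolynomial L K) (hf : f ≠ 0) (hd : f.IsHomogeneous d)
    (hg : g ∉ ladIdeal K L (k + 1)) (hgf : g * f ∈ ladIdeal K L (k + 1) ^ s) :
    ∃ e : Fin M → ℕ, ∑ c, e c = d ∧ ∀ S : Finset (Fin M), S.card = q → s ≤ ∑ c ∈ S, e c := by
  classical
  have h1 : param K L (Finset.univ : Finset (Fin M)) f ≠ 0 :=
    star_param _ f hf (fun m _ x => by simpa using hM _ x)
  have h2 : ∀ T ∈ (Finset.univ : Finset (Fin M)).powersetCard k, param K L T g ≠ 0 := by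
    intro T hT h0
    rw [ladIdeal_eq_ker hladder T (Finset.mem_powersetCard.1 hT).2] at hg
    exact hg h0
  have h3 : param K L (Finset.univ : Finset (Fin M)) f *
      ∏ T ∈ (Finset.univ : Finset (Fin M)).powersetCard k, param K L T g ≠ 0 :=
    mul_ne_zero h1 (Finset.prod_ne_zero_iff.2 h2)
  obtain ⟨pt, hpt⟩ : ∃ pt, eval pt (param K L (Finset.univ : Finset (Fin M)) f *
      ∏ T ∈ (Finset.univ : Finset (Fin M)).powersetCard k, param K L T g) ≠ 0 := by
    by_contra h
    push Not at h
    exact h3 (MvPolynomial.funext fun x => by rw [h x, map_zero])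
  rw [map_mul, map_prod] at hpt
  have h4 := left_ne_zero_of_mul hpt
  have h5 := Finset.prod_ne_zero_iff.1 (right_ne_zero_of_mul hpt)
  let θ : MvPolynomial L K →ₐ[K] MvPolynomial (Fin M) K := aeval fun x => ∑ c,
    C (pt (Sum.inl (x.1.1, c)) * pt (Sum.inr (c, x.1.2))) * X c
  have hθf : θ f ≠ 0 := by
    intro h0
    apply h4
    rw [eval_param]
    have : (aeval (fun _ : Fin M => (1 : K)) : MvPolynomial (Fin M) K →ₐ[K] K).comp θ =
        aeval (fun x : L => ∑ a, pt (Sum.inl (x.1.1, a)) * pt (Sum.inr (a, x.1.2))) := by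
      ext x
      simp [θ]
    have := congrArg (fun φ => φ f) this
    simp only [AlgHom.comp_apply, h0, map_zero] at this
    rw [← MvPolynomial.coe_aeval_eq_eval]
    exact this.symm
  have hθd : (θ f).IsHomogeneous d := by
    have := hd.aeval (fun x : L => ∑ c,
      C (pt (Sum.inl (x.1.1, c)) * pt (Sum.inr (c, x.1.2))) * (X c : MvPolynomial (Fin M) K)) (n := 1)
      (fun x => IsHomogeneous.sum _ _ _ fun c _ => by
        simpa using (isHomogeneous_C (Fin M) (pt (Sum.inl (x.1.1, c)) * pt (Sum.inr (c, x.1.2)))).mul (isHomogeneous_X K c))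
    rw [one_mul] at this
    exact this
  obtain ⟨e, he⟩ : (θ f).support.Nonempty := by
    rwa [Finset.nonempty_iff_ne_empty, Ne, MvPolynomial.support_eq_empty]
  have hee := mem_support_iff.1 he
  refine ⟨e, ?_, ?_⟩
  · have := hθd hee
    rw [Finsupp.weight_apply, Finsupp.sum_fintype _ _ (by simp)] at this
    simpa using this
  intro S hS
  let τ : MvPolynomial (Fin M) K →ₐ[K] Polynomial (MvPolynomial (Fin M) K) := aeval fun c =>
    if c ∈ S then Polynomial.X * Polynomial.C (X c) else Polynomial.C (X c)
  have hSc : (Sᶜ).card = k := by rw [Finset.card_compl, Fintype.card_fin, hS]; omega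
  -- the constant term factors through `param`
  have hfac : ∀ p, Polynomial.constantCoeff (τ (θ p)) =
      aeval (Sum.elim (fun x : Fin r × Fin M => C (pt (Sum.inl x)))
        (fun x : Fin M × Fin n => C (pt (Sum.inr x)) * X x.1)) (param K L Sᶜ p) := by
    intro p
    have : ((Polynomial.aeval (0 : MvPolynomial (Fin M) K)).restrictScalars K).comp (τ.comp θ) =
      (aeval (Sum.elim (fun x : Fin r × Fin M => C (pt (Sum.inl x)))
        (fun x : Fin M × Fin n => C (pt (Sum.inr x)) * X x.1)) :
          _ →ₐ[K] MvPolynomial (Fin M) K).comp (param K L Sᶜ) := by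
      ext1 x
      simp only [AlgHom.comp_apply, θ, τ, param, aeval_X, map_sum, map_mul, Sum.elim_inl, Sum.elim_inr]
      rw [← Finset.sum_add_sum_compl S, Finset.sum_eq_zero, zero_add]
      · refine Finset.sum_congr rfl fun c hc => ?_
        rw [if_neg (Finset.mem_compl.1 hc)]
        simp [mul_assoc]
      · intro c hc
        rw [if_pos hc]
        simp
    have := congrArg (fun φ => φ p) this
    simp only [AlgHom.comp_apply] at this
    rw [← this]
    simp [Polynomial.coeff_zero_eq_aeval_zero]
  have hgX : ¬ Polynomial.X ∣ τ (θ g) := by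
    rw [Polynomial.X_dvd_iff, ← Polynomial.constantCoeff_apply, hfac]
    intro h0
    refine h5 Sᶜ (Finset.mem_powersetCard.2 ⟨Finset.subset_univ _, hSc⟩) ?_
    have h6 := congrArg (aeval (fun _ : Fin M => (1 : K))) h0
    rw [map_zero] at h6
    have : (aeval (fun _ : Fin M => (1 : K)) : _ →ₐ[K] K).comp
      (aeval (Sum.elim (fun x : Fin r × Fin M => C (pt (Sum.inl x)))
        (fun x : Fin M × Fin n => C (pt (Sum.inr x)) * X x.1)) :
          _ →ₐ[K] MvPolynomial (Fin M) K) = aeval pt := by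
      ext x
      rcases x with x | x <;> simp
    have := congrArg (fun φ => φ (param K L Sᶜ g)) this
    simp only [AlgHom.comp_apply] at this
    rw [h6] at this
    rw [← MvPolynomial.coe_aeval_eq_eval]
    exact this.symm
  have hmap : ladIdeal K L (k + 1) ≤ Ideal.comap (τ.comp θ) (Ideal.span {Polynomial.X}) := by
    intro p hp
    rw [ladIdeal_eq_ker hladder Sᶜ hSc] at hp
    have hp : param K L Sᶜ p = 0 := hp
    rw [Ideal.mem_comap, Ideal.mem_span_singleton, AlgHom.comp_apply, Polynomial.X_dvd_iff,
      ← Polynomial.constantCoeff_apply, hfac, hp, map_zero]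
  have hXs : Polynomial.X ^ s ∣ τ (θ g) * τ (θ f) := by
    have h6 := (Ideal.pow_right_mono hmap s).trans (Ideal.le_comap_pow _ s) hgf
    rw [Ideal.mem_comap, Ideal.span_singleton_pow, Ideal.mem_span_singleton, map_mul] at h6
    exact h6
  have hXf := Polynomial.prime_X.pow_dvd_of_dvd_mul_left s hgX hXs
  rw [Polynomial.X_pow_dvd_iff] at hXf
  by_contra hlt
  push Not at hlt
  have h6 := hXf _ hlt
  have hτ : τ (θ f) = ∑ m ∈ (θ f).support,
      Polynomial.C (monomial m (coeff m (θ f))) * Polynomial.X ^ (∑ c ∈ S, m c) := by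
    conv_lhs => rw [(θ f).as_sum]
    rw [map_sum]
    refine Finset.sum_congr rfl fun m _ => ?_
    simp only [τ]
    rw [aeval_monomial, Finsupp.prod_fintype _ _ (by simp), monomial_eq,
      Finsupp.prod_fintype _ _ (by simp)]
    have : ∀ c, (if c ∈ S then Polynomial.X * Polynomial.C (X c) else Polynomial.C (X c :
      MvPolynomial (Fin M) K)) ^ m c = Polynomial.C (X c ^ m c) * (if c ∈ S then Polynomial.X ^ m c else 1) := by
      intro c
      split_ifs
      · rw [mul_pow, mul_comm, map_pow]
      · rw [map_pow, mul_one]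
    simp only [this]
    rw [Finset.prod_mul_distrib, map_mul, map_prod, Finset.prod_ite_mem, Finset.univ_inter,
      Finset.prod_pow_eq_pow_sum, ← mul_assoc]
    rfl
  rw [hτ, Polynomial.finset_sum_coeff] at h6
  have h7 := congrArg (coeff e) h6
  rw [coeff_sum, Finset.sum_eq_single e] at h7
  · rw [Polynomial.coeff_C_mul, Polynomial.coeff_X_pow, if_pos rfl, mul_one, coeff_monomial, if_pos rfl,
      coeff_zero] at h7
    exact hee h7
  · intro m _ hme
    rw [Polynomial.coeff_C_mul, Polynomial.coeff_X_pow]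
    split_ifs
    · rw [mul_one, coeff_monomial, if_neg hme]
    · simp
  · intro h; exact absurd he h

end

section
variable {K : Type*} [Field K] {r n : ℕ} {L : Set (Fin r × Fin n)} {k : ℕ}

lemma exists_D [Infinite K]
    (hladder : ∀ (i p : Fin r) (j q : Fin n),
      (i, j) ∈ L → (p, q) ∈ L → i < p → j < q → (i, q) ∈ L ∧ (p, j) ∈ L) {m q : ℕ}
    (hkq : k + q ≤ m)
    (hm : ∃ (ri : Fin m → Fin r) (ci : Fin m → Fin n),
      Function.Injective ri ∧ Function.Injective ci ∧ ∀ a b, (ri a, ci b) ∈ L) :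
    ∃ D : MvPolynomial L K, D ≠ 0 ∧ D.IsHomogeneous (k + q) ∧
      ∃ g, g ∉ ladIdeal K L (k + 1) ∧ g * D ∈ ladIdeal K L (k + 1) ^ q := by
  classical
  obtain ⟨ri, ci, hr, hc, h⟩ := hm
  let ψ : Fin k ⊕ Fin q → Fin m := fun x => Fin.castLE hkq (finSumFinEquiv x)
  have hψ : Function.Injective ψ :=
    (Fin.castLE_injective hkq).comp finSumFinEquiv.injective
  refine ⟨gmin K L (ri ∘ ψ) (ci ∘ ψ) (fun _ _ => h _ _), ?_, ?_, ?_⟩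
  · intro h0
    refine gmin_param_ne (K := K) (L := L) (Finset.univ : Finset (Fin k ⊕ Fin q)) rfl (ri ∘ ψ) (ci ∘ ψ)
      (fun _ _ => h _ _) (hr.comp hψ) (hc.comp hψ) ?_
    rw [h0, map_zero]
  · have := gmin_hom (K := K) (L := L) (ri ∘ ψ) (ci ∘ ψ) (fun _ _ => h _ _)
    simpa using this
  · exact gmin_symb hladder _ _ _ (hr.comp hψ) (hc.comp hψ)

lemma alpha_eq [Infinite K]
    (hladder : ∀ (i p : Fin r) (j q : Fin n),
      (i, j) ∈ L → (p, q) ∈ L → i < p → j < q → (i, q) ∈ L ∧ (p, j) ∈ L) {m q : ℕ}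
    (hkq : k + q = m)
    (hm : ∃ (ri : Fin m → Fin r) (ci : Fin m → Fin n),
      Function.Injective ri ∧ Function.Injective ci ∧ ∀ a b, (ri a, ci b) ∈ L)
    (hmax : ∀ m' : ℕ, (∃ (ri : Fin m' → Fin r) (ci : Fin m' → Fin n),
      Function.Injective ri ∧ Function.Injective ci ∧ ∀ a b, (ri a, ci b) ∈ L) → m' ≤ m)
    (u l : ℕ) (hl : l < q) :
    alphaDeg (symbolicPower (ladIdeal K L (k + 1)) ((u + 1) * q - l)) = (u + 1) * m - l := by
  classical
  have hP := ladIdeal_prime (K := K) (k := k) hladder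
  have hmem : (u + 1) * m - l ∈ {d | ∃ f ∈ symbolicPower (ladIdeal K L (k + 1)) ((u + 1) * q - l),
      f ≠ 0 ∧ MvPolynomial.IsHomogeneous f d} := by
    obtain ⟨D, hD0, hDh, g, hg, hgD⟩ := exists_D (K := K) (q := q) hladder hkq.le hm
    obtain ⟨D', hD0', hDh', g', hg', hgD'⟩ :=
      exists_D (K := K) (k := k) (q := q - l) hladder (by omega) hm
    refine ⟨D ^ u * D', ?_, mul_ne_zero (pow_ne_zero _ hD0) hD0', ?_⟩
    · rw [mem_symbolicPower_iff hP]
      refine ⟨g ^ u * g', fun h => ?_, ?_⟩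
      · rcases hP.mem_or_mem h with h | h
        · exact hg (hP.mem_of_pow_mem _ h)
        · exact hg' h
      · have h1 : (u + 1) * q - l = q * u + (q - l) := by
          rw [add_mul, one_mul, mul_comm u q]; omega
        rw [h1, pow_add, pow_mul, mul_mul_mul_comm, ← mul_pow]
        exact Ideal.mul_mem_mul (Ideal.pow_mem_pow hgD u) hgD'
    · have h1 : (u + 1) * m - l = (k + q) * u + (k + (q - l)) := by
        rw [hkq, add_mul, one_mul, mul_comm u m]; omega
      rw [h1]
      exact (hDh.pow u).mul hDh'
  apply le_antisymm
  · exact Nat.sInf_le hmem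
  · refine le_csInf ⟨_, hmem⟩ ?_
    rintro d ⟨f, hf, hf0, hfd⟩
    rw [mem_symbolicPower_iff hP] at hf
    obtain ⟨g, hg, hgf⟩ := hf
    have hM : ∀ (S : Set L) x, ¬ ChainTo (ladEmb '' S) m x := by
      intro S x hx
      obtain ⟨ri, ci, h, hr, hc, -⟩ := exists_minor hladder hx
      have := hmax (m + 1) ⟨ri, ci, hr.injective, hc.injective, h⟩
      omega
    obtain ⟨e, hed, he⟩ := lower_bound hladder hkq hM f g hf0 hfd hg hgf
    obtain ⟨N, hN1, hN2⟩ := comb_bound hkq e he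
    have hN : u + 1 ≤ N := by
      by_contra hlt
      have : N ≤ u := by omega
      have h2 : q * N ≤ q * u := Nat.mul_le_mul_left _ this
      rw [add_mul, one_mul, mul_comm u q] at hN1
      omega
    have h3 : k * (u + 1) ≤ k * N := Nat.mul_le_mul_left _ hN
    have h4 : (u + 1) * m = k * (u + 1) + (u + 1) * q := by rw [← hkq]; ring
    have h5 : l ≤ (u + 1) * q := by rw [add_mul, one_mul]; omega
    rw [hed] at hN2
    omega

end

lemma tendsto_aux {q m : ℕ} (hq : 0 < q) (hqm : q ≤ m) (α : ℕ → ℕ)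
    (h : ∀ u l, l < q → α ((u + 1) * q - l) = (u + 1) * m - l) :
    Tendsto (fun s : ℕ => (α s : ℝ) / s) atTop (nhds ((m : ℝ) / q)) := by
  have hq' : (0 : ℝ) < q := by exact_mod_cast hq
  have key : ∀ s : ℕ, 1 ≤ s → |(α s : ℝ) / s - (m : ℝ) / q| ≤ (m : ℝ) / s := by
    intro s hs
    obtain ⟨u, l, hl, hsu⟩ : ∃ u l, l < q ∧ s + l = (u + 1) * q := by
      refine ⟨(s - 1) / q, q - 1 - (s - 1) % q, by omega, ?_⟩
      have h1 := Nat.div_add_mod (s - 1) q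
      have h2 := Nat.mod_lt (s - 1) hq
      rw [add_mul, one_mul, mul_comm _ q]
      omega
    have hs' : s = (u + 1) * q - l := by omega
    have hα : α s + l = (u + 1) * m := by
      rw [hs', h u l hl]
      have : q ≤ (u + 1) * m := hqm.trans (Nat.le_mul_of_pos_left _ (by omega))
      omega
    have e1 : (s : ℝ) + l = (u + 1) * q := by exact_mod_cast hsu
    have e2 : (α s : ℝ) + l = (u + 1) * m := by exact_mod_cast hα
    have hs0 : (0 : ℝ) < s := by exact_mod_cast hs
    have hl' : (l : ℝ) ≤ q := by exact_mod_cast hl.le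
    have hl0 : (0 : ℝ) ≤ l := by positivity
    have hqm' : (q : ℝ) ≤ m := by exact_mod_cast hqm
    have e3 : (α s : ℝ) / s - (m : ℝ) / q = (l * (m - q) / q) / s := by
      have ea : (α s : ℝ) = (u + 1) * m - l := by linarith
      have es : (u + 1 : ℝ) = (s + l) / q := by rw [e1]; field_simp
      rw [ea, es]
      field_simp
      ring
    rw [e3, abs_of_nonneg (by
      have : (0 : ℝ) ≤ m - q := by linarith
      positivity)]
    gcongr
    rw [div_le_iff₀ hq']
    nlinarith
  rw [tendsto_iff_norm_sub_tendsto_zero]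
  refine squeeze_zero' (Eventually.of_forall fun _ => norm_nonneg _) ?_
    (tendsto_const_div_atTop_nhds_zero_nat (m : ℝ))
  filter_upwards [eventually_ge_atTop 1] with s hs
  exact key s hs

/-- Theorem 4.3: let `L` be a ladder of the generic `r × n` matrix `X`, `R = k[L]`, `I_t(L)`
the ideal of `t × t` minors of `X` whose entries all lie in `L`, and `m` the largest size of a
square submatrix of `X` all of whose entries belong to `L`. Then for `1 ≤ t ≤ m`,
`α(I_t(L)^{(k(m-t+1)-l)}) = km - l` for `k ≥ 1` and `0 ≤ l ≤ m - t`, and the Waldschmidt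
constant of `I_t(L)` equals `m/(m-t+1)`. -/
theorem ladder_determinantal_alpha_waldschmidt {K : Type*} [Field K] [CharZero K]
    (r n : ℕ) (hrn : r ≤ n) (L : Set (Fin r × Fin n))
    (hladder : ∀ (i p : Fin r) (j q : Fin n),
      (i, j) ∈ L → (p, q) ∈ L → i < p → j < q → (i, q) ∈ L ∧ (p, j) ∈ L)
    (m : ℕ)
    (hm : ∃ (ri : Fin m → Fin r) (ci : Fin m → Fin n),
      Function.Injective ri ∧ Function.Injective ci ∧ ∀ a b, (ri a, ci b) ∈ L)
    (hmax : ∀ m' : ℕ, (∃ (ri : Fin m' → Fin r) (ci : Fin m' → Fin n),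
      Function.Injective ri ∧ Function.Injective ci ∧ ∀ a b, (ri a, ci b) ∈ L) → m' ≤ m)
    (t : ℕ) (ht1 : 1 ≤ t) (htm : t ≤ m) :
    let I : Ideal (MvPolynomial L K) := Ideal.span {d |
      ∃ (ri : Fin t → Fin r) (ci : Fin t → Fin n) (h : ∀ a b, (ri a, ci b) ∈ L),
        Function.Injective ri ∧ Function.Injective ci ∧
        d = Matrix.det (Matrix.of fun a b =>
          (MvPolynomial.X ⟨(ri a, ci b), h a b⟩ : MvPolynomial L K))}
    (∀ k l : ℕ, 1 ≤ k → l ≤ m - t →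
      alphaDeg (symbolicPower I (k * (m - t + 1) - l)) = k * m - l) ∧
    Tendsto (fun s : ℕ => (alphaDeg (symbolicPower I s) : ℝ) / s) atTop
      (nhds ((m : ℝ) / ((m : ℝ) - t + 1))) := by
  obtain ⟨k, rfl⟩ : ∃ k, t = k + 1 := ⟨t - 1, by omega⟩
  intro I
  have hI : I = ladIdeal K L (k + 1) := rfl
  clear_value I
  subst hI
  have : Infinite K := inferInstance
  obtain ⟨q, hq⟩ : ∃ q, k + (q + 1) = m := ⟨m - (k + 1), by omega⟩
  have hq2 : m - (k + 1) + 1 = q + 1 := by omega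
  have key := alpha_eq (K := K) hladder hq hm hmax
  refine ⟨?_, ?_⟩
  · intro u l hu hl
    obtain ⟨u, rfl⟩ : ∃ v, u = v + 1 := ⟨u - 1, by omega⟩
    rw [hq2]
    exact key u l (by omega)
  · have h1 := tendsto_aux (q := q + 1) (m := m) (by omega) (by omega)
      (fun s => alphaDeg (symbolicPower (ladIdeal K L (k + 1)) s)) key
    have h2 : (m : ℝ) - ((k + 1 : ℕ) : ℝ) + 1 = ((q + 1 : ℕ) : ℝ) := by
      rw [← hq]; push_cast; ring
    rw [h2]
    exact h1
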